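/- There exists δ > 0 such that for every real v with 0 < |v| < δ, there is a unique quadruple (b0, b1, b2, b3) ∈ ℝ^4 satisfying simultaneously: N(v, b0, b1, b2, b3) = 0, (∂N/∂v)(v, b0, b1, b2, b3) = 0 (partial derivative in v with b0,…,b3 held fixed), b0 = -95/6 + 16·b3 + 6·b2, and b1 = 125/12 - 9·b3 - 4·b2. (This quadruple gives the 8-step method with zero phase-lag and zero first derivative of the phase-lag.) -/

import Mathlib

/-- Phase-lag numerator of the symmetric 8-step method. -/
noncomputable def N (v b0 b1 b2 b3 : ℝ) : ℝ :=
  16 * Real.cos v ^ 4 + (8 * b3 * v ^ 2 - 16) * Real.cos v ^ 3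
    + (4 * b2 * v ^ 2 - 8) * Real.cos v ^ 2
    + (10 + (2 * b1 - 6 * b3) * v ^ 2) * Real.cos v - 2
    + (b0 - 2 * b2) * v ^ 2

theorem hasDerivAt_N (v b0 b1 b2 b3 : ℝ) :
    HasDerivAt (fun w => N w b0 b1 b2 b3)
      (-Real.sin v * (64 * Real.cos v ^ 3 + 3 * (8 * b3 * v ^ 2 - 16) * Real.cos v ^ 2
          + 2 * (4 * b2 * v ^ 2 - 8) * Real.cos v + (10 + (2 * b1 - 6 * b3) * v ^ 2))
        + 2 * v * (8 * b3 * Real.cos v ^ 3 + 4 * b2 * Real.cos v ^ 2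
          + (2 * b1 - 6 * b3) * Real.cos v + (b0 - 2 * b2))) v := by
  have hc := Real.hasDerivAt_cos v
  have hv : HasDerivAt (fun w : ℝ => w ^ 2) (2 * v) v := by
    simpa using hasDerivAt_pow 2 v
  have h := ((((((hc.pow 4).const_mul 16).add
    (((hv.const_mul (8 * b3)).sub_const 16).mul (hc.pow 3))).add
    (((hv.const_mul (4 * b2)).sub_const 8).mul (hc.pow 2))).add
    (((hv.const_mul (2 * b1 - 6 * b3)).const_add 10).mul hc)).sub_const 2).add
    (hv.const_mul (b0 - 2 * b2))
  refine h.congr_deriv ?_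
  simp only [Pi.pow_apply]
  push_cast
  ring

/-- A nonsingular affine system of two equations in two unknowns has a unique solution. -/
theorem existsUnique_two_by_two {K : Type*} [Field K] {p q r s : K} (e f : K)
    (hdet : p * s - q * r ≠ 0) :
    ∃! x : K × K, p * x.1 + q * x.2 + e = 0 ∧ r * x.1 + s * x.2 + f = 0 := by
  refine ⟨((q * f - s * e) / (p * s - q * r), (r * e - p * f) / (p * s - q * r)),
    ⟨?_, ?_⟩, ?_⟩
  · rw [mul_div_assoc', mul_div_assoc', ← add_div, div_add' _ _ _ hdet, div_eq_zero_iff]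
    left
    ring
  · rw [mul_div_assoc', mul_div_assoc', ← add_div, div_add' _ _ _ hdet, div_eq_zero_iff]
    left
    ring
  · rintro ⟨x, y⟩ ⟨h₁, h₂⟩
    ext
    · rw [eq_div_iff hdet]
      linear_combination s * h₁ - q * h₂
    · rw [eq_div_iff hdet]
      linear_combination p * h₂ - r * h₁

/-- For all sufficiently small nonzero `v` there is a unique coefficient
quadruple with zero phase-lag, zero first derivative of the phase-lag, and
the two maximal-algebraic-order relations. -/
theorem exists_unique_coeffs_zero_PL_PL' :
    ∃ δ : ℝ, 0 < δ ∧ ∀ v : ℝ, 0 < |v| → |v| < δ →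
      ∃! b : ℝ × ℝ × ℝ × ℝ,
        N v b.1 b.2.1 b.2.2.1 b.2.2.2 = 0 ∧
        deriv (fun w => N w b.1 b.2.1 b.2.2.1 b.2.2.2) v = 0 ∧
        b.1 = -95 / 6 + 16 * b.2.2.2 + 6 * b.2.2.1 ∧
        b.2.1 = 125 / 12 - 9 * b.2.2.2 - 4 * b.2.2.1 := by
  refine ⟨Real.pi, Real.pi_pos, fun v hv hvπ => ?_⟩
  have hv0 : v ≠ 0 := abs_pos.mp hv
  have hs : Real.sin v ≠ 0 := fun h =>
    hv0 ((Real.sin_eq_zero_iff_of_lt_of_lt (abs_lt.mp hvπ).1 (abs_lt.mp hvπ).2).mp h)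
  have hc : Real.cos v - 1 ≠ 0 := fun h => hs <| by
    have := Real.sin_sq_add_cos_sq v
    rw [sub_eq_zero.mp h] at this
    exact pow_eq_zero_iff two_ne_zero |>.mp (by linarith)
  simp only [(hasDerivAt_N v _ _ _ _).deriv]
  unfold N
  generalize Real.cos v = c at *
  generalize Real.sin v = s at *
  have hdet : (4 * v ^ 2 * (c - 1) ^ 2)
        * (16 * v * (c - 1) ^ 2 * (c + 2) - 24 * v ^ 2 * s * (c ^ 2 - 1))
      - (8 * v ^ 2 * (c - 1) ^ 2 * (c + 2))
        * (8 * v * (c - 1) ^ 2 - 8 * v ^ 2 * s * (c - 1)) ≠ 0 := by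
    have h : -32 * v ^ 4 * s * (c - 1) ^ 4 ≠ 0 := by simp [hv0, hs, hc]
    convert h using 1
    ring
  obtain ⟨⟨b2, b3⟩, ⟨h₁, h₂⟩, huniq⟩ := existsUnique_two_by_two
    (16 * c ^ 4 - 16 * c ^ 3 - 8 * c ^ 2 + 10 * c - 2 + v ^ 2 * (125 * c - 95) / 6)
    (-s * (64 * c ^ 3 - 48 * c ^ 2 - 16 * c + 10 + 125 / 6 * v ^ 2)
      + v * (125 * c - 95) / 3) hdet
  refine ⟨(-95 / 6 + 16 * b3 + 6 * b2, 125 / 12 - 9 * b3 - 4 * b2, b2, b3),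
    ⟨?_, ?_, rfl, rfl⟩, ?_⟩
  · linear_combination h₁
  · linear_combination h₂
  · rintro ⟨a0, a1, a2, a3⟩ ⟨g₁, g₂, g₃, g₄⟩
    dsimp only at g₁ g₂ g₃ g₄
    subst g₃ g₄
    have h := huniq (a2, a3) ⟨by linear_combination g₁, by linear_combination g₂⟩
    simp only [Prod.mk.injEq] at h
    rw [h.1, h.2]
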